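/- arXiv:1105.5807 — 6 statements merged into one kernel-verified Lean document; each statement's English description precedes it below -/
import Mathlib

section
/- Let (g, Φ = (D, θ), ⟨·,·⟩) be an indecomposable extrinsic symmetric triple with n = dim g₋⁻ ≥ 1, let h be its mean curvature vector and A_h the associated shape operator on g₋⁻. Then A_h ∘ A_h ≠ 0 if and only if the Lie algebra g is semisimple (i.e., its Killing form B_g(x,y) = tr(ad x ∘ ad y) is nondegenerate). -/
/-- The span of all brackets `⁅u, v⁆` with `u ∈ U`, `v ∈ V`. -/
def bracketSpan {L : Type} [LieRing L] [LieAlgebra ℝ L]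
    (U V : Submodule ℝ L) : Submodule ℝ L :=
  Submodule.span ℝ {z | ∃ u ∈ U, ∃ v ∈ V, z = ⁅u, v⁆}

/-- An extrinsic symmetric triple `(g, (D, θ), ⟨·,·⟩)`: a metric Lie algebra with an
invariant nondegenerate symmetric bilinear form, an isometric involutive automorphism `θ`,
and an antisymmetric derivation `D` with `D³ = -D`, `Dθ = -θD` and `g₊⁺ = [g₊⁻, g₊⁻]`. -/
structure ExtSymTriple (L : Type) [LieRing L] [LieAlgebra ℝ L] [Module.Finite ℝ L] where
  B : LinearMap.BilinForm ℝ L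
  Bsymm : ∀ x y, B x y = B y x
  Binv : ∀ x y z, B ⁅x, y⁆ z = B x ⁅y, z⁆
  Bnondeg : B.Nondegenerate
  theta : L →ₗ[ℝ] L
  thetaLie : ∀ x y, theta ⁅x, y⁆ = ⁅theta x, theta y⁆
  thetaInvol : ∀ x, theta (theta x) = x
  thetaIso : ∀ x y, B (theta x) (theta y) = B x y
  D : L →ₗ[ℝ] L
  Dder : ∀ x y, D ⁅x, y⁆ = ⁅D x, y⁆ + ⁅x, D y⁆
  Danti : ∀ x y, B (D x) y = - B x (D y)
  D3 : ∀ x, D (D (D x)) = - D x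
  Dtheta : ∀ x, D (theta x) = - theta (D x)
  cartan : (LinearMap.ker (theta - LinearMap.id) ⊓ LinearMap.ker D) =
    bracketSpan
      (LinearMap.ker (theta - LinearMap.id) ⊓ LinearMap.ker (D ∘ₗ D + LinearMap.id))
      (LinearMap.ker (theta - LinearMap.id) ⊓ LinearMap.ker (D ∘ₗ D + LinearMap.id))

namespace ExtSymTriple

variable {L : Type} [LieRing L] [LieAlgebra ℝ L] [Module.Finite ℝ L] (T : ExtSymTriple L)

/-- `g₊⁺ = g₊ ∩ g⁺`. -/
def gPlusUp : Submodule ℝ L :=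
  LinearMap.ker (T.theta - LinearMap.id) ⊓ LinearMap.ker T.D

/-- `g₊⁻ = g₊ ∩ g⁻`. -/
def gPlusDown : Submodule ℝ L :=
  LinearMap.ker (T.theta - LinearMap.id) ⊓ LinearMap.ker (T.D ∘ₗ T.D + LinearMap.id)

/-- `g₋⁺ = g₋ ∩ g⁺`. -/
def gMinusUp : Submodule ℝ L :=
  LinearMap.ker (T.theta + LinearMap.id) ⊓ LinearMap.ker T.D

/-- `g₋⁻ = g₋ ∩ g⁻`. -/
def gMinusDown : Submodule ℝ L :=
  LinearMap.ker (T.theta + LinearMap.id) ⊓ LinearMap.ker (T.D ∘ₗ T.D + LinearMap.id)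

/-- Indecomposability: `g` is not the direct sum of two nonzero ideals that are orthogonal
to each other and invariant under `θ` and `D`. -/
def Indecomposable : Prop :=
  ¬ ∃ I J : LieIdeal ℝ L, I ≠ ⊥ ∧ J ≠ ⊥ ∧
    (I : Submodule ℝ L) ⊓ (J : Submodule ℝ L) = ⊥ ∧
    (I : Submodule ℝ L) ⊔ (J : Submodule ℝ L) = ⊤ ∧
    (∀ x ∈ I, ∀ y ∈ J, T.B x y = 0) ∧
    (∀ x ∈ I, T.theta x ∈ I) ∧ (∀ x ∈ I, T.D x ∈ I) ∧
    (∀ x ∈ J, T.theta x ∈ J) ∧ (∀ x ∈ J, T.D x ∈ J)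

end ExtSymTriple

namespace ExtSymTriple

open LieAlgebra

lemma killingForm_eq_trace {L : Type} [LieRing L] [LieAlgebra ℝ L] (x y : L) :
    killingForm ℝ L x y = LinearMap.trace ℝ L (ad ℝ L x * ad ℝ L y) :=
  killingForm_apply_apply ℝ L x y

variable {L : Type} [LieRing L] [LieAlgebra ℝ L] [Module.Finite ℝ L] (T : ExtSymTriple L)

lemma eq_of_forall_form {x y : L} (hxy : ∀ z, T.B x z = T.B y z) : x = y := by
  refine sub_eq_zero.mp (T.Bnondeg.1 _ fun z ↦ ?_)
  simp [hxy z]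

lemma form_theta (x y : L) : T.B x (T.theta y) = T.B (T.theta x) y := by
  rw [← T.thetaIso, T.thetaInvol]

lemma ad_D (x : L) : ad ℝ L (T.D x) = T.D * ad ℝ L x - ad ℝ L x * T.D := by
  ext y
  simp [T.Dder]

lemma theta_mul_theta : (T.theta * T.theta : Module.End ℝ L) = 1 :=
  LinearMap.ext T.thetaInvol

lemma ad_theta (x : L) : ad ℝ L (T.theta x) = T.theta * ad ℝ L x * T.theta := by
  ext y
  simp [T.thetaLie, T.thetaInvol]

lemma D_cube : (T.D * T.D * T.D : Module.End ℝ L) = -T.D :=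
  LinearMap.ext T.D3

/-! ### The Killing form -/

lemma killingForm_theta (x y : L) :
    killingForm ℝ L (T.theta x) (T.theta y) = killingForm ℝ L x y := by
  rw [killingForm_eq_trace, killingForm_eq_trace, ad_theta, ad_theta,
    show T.theta * ad ℝ L x * T.theta * (T.theta * ad ℝ L y * T.theta) =
      T.theta * (ad ℝ L x * (T.theta * T.theta) * ad ℝ L y * T.theta) by noncomm_ring,
    LinearMap.trace_mul_comm, T.theta_mul_theta, mul_one, mul_assoc, T.theta_mul_theta, mul_one]

lemma killingForm_D (x y : L) :
    killingForm ℝ L (T.D x) y = -killingForm ℝ L x (T.D y) := by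
  rw [killingForm_eq_trace, killingForm_eq_trace, ad_D, ad_D, ← sub_eq_zero, sub_neg_eq_add,
    ← map_add,
    show (T.D * ad ℝ L x - ad ℝ L x * T.D) * ad ℝ L y +
        ad ℝ L x * (T.D * ad ℝ L y - ad ℝ L y * T.D) =
      T.D * (ad ℝ L x * ad ℝ L y) - (ad ℝ L x * ad ℝ L y) * T.D by noncomm_ring,
    map_sub, LinearMap.trace_mul_comm, sub_self]

/-- The endomorphism representing the Killing form with respect to the metric. -/
noncomputable def killingMap : Module.End ℝ L :=
  LinearMap.BilinForm.symmCompOfNondegenerate (killingForm ℝ L) T.B T.Bnondeg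

lemma form_killingMap (x y : L) : T.B (T.killingMap x) y = killingForm ℝ L x y :=
  LinearMap.BilinForm.symmCompOfNondegenerate_left_apply _ T.Bnondeg y x

lemma killingMap_lie (x y : L) : T.killingMap ⁅x, y⁆ = ⁅T.killingMap x, y⁆ :=
  T.eq_of_forall_form fun z ↦ by
    rw [form_killingMap, T.Binv, form_killingMap, LieModule.traceForm_apply_lie_apply]

lemma killingMap_symm (x y : L) : T.B (T.killingMap x) y = T.B x (T.killingMap y) := by
  rw [T.Bsymm x, form_killingMap, form_killingMap, LieModule.traceForm_comm]

lemma lie_killingMap (x y : L) : T.killingMap ⁅x, y⁆ = ⁅x, T.killingMap y⁆ := by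
  rw [← lie_skew, map_neg, killingMap_lie, lie_skew]

lemma killingMap_theta (x : L) : T.killingMap (T.theta x) = T.theta (T.killingMap x) :=
  T.eq_of_forall_form fun z ↦ by
    rw [← T.form_theta, form_killingMap, form_killingMap, ← T.killingForm_theta, T.thetaInvol]

lemma killingMap_D (x : L) : T.killingMap (T.D x) = T.D (T.killingMap x) :=
  T.eq_of_forall_form fun z ↦ by
    rw [T.Danti, form_killingMap, form_killingMap, T.killingForm_D]

lemma killingForm_nondegenerate_of_injective (hinj : Function.Injective T.killingMap) :
    (killingForm ℝ L).Nondegenerate := by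
  have hleft (x : L) (hx : ∀ y, killingForm ℝ L x y = 0) : x = 0 := by
    refine hinj (T.eq_of_forall_form fun z ↦ ?_)
    rw [form_killingMap, hx, map_zero, map_zero, LinearMap.zero_apply]
  exact ⟨hleft, fun y hy ↦ hleft y fun x ↦ by rw [LieModule.traceForm_comm, hy]⟩

lemma killingMap_injective (hK : (killingForm ℝ L).Nondegenerate) :
    Function.Injective T.killingMap := by
  refine (injective_iff_map_eq_zero _).mpr fun x hx ↦ hK.1 x fun y ↦ ?_
  rw [← form_killingMap, hx, map_zero, LinearMap.zero_apply]

/-- If the Killing map is nilpotent then it squares to zero: `K(φ x, y)` is the trace of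
`φ ∘ ad x ∘ ad y`, whose factors commute. -/
lemma killingMap_sq_eq_zero_of_isNilpotent (hnil : IsNilpotent T.killingMap) (x : L) :
    T.killingMap (T.killingMap x) = 0 := by
  refine T.eq_of_forall_form fun y ↦ ?_
  have had : ad ℝ L (T.killingMap x) = T.killingMap * ad ℝ L x := by
    ext z
    simp [killingMap_lie]
  have hcomm : Commute T.killingMap (ad ℝ L x * ad ℝ L y) := by
    ext z
    simp [lie_killingMap]
  rw [form_killingMap, killingForm_eq_trace, had, mul_assoc, map_zero, LinearMap.zero_apply]
  exact (LinearMap.isNilpotent_trace_of_isNilpotent (hcomm.isNilpotent_mul_right hnil)).eq_zero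

section Fitting

variable (k : ℕ)

lemma killingMap_pow_commute (f : Module.End ℝ L)
    (hf : ∀ x, T.killingMap (f x) = f (T.killingMap x)) (x : L) :
    (T.killingMap ^ k) (f x) = f ((T.killingMap ^ k) x) :=
  LinearMap.congr_fun ((show Commute T.killingMap f from LinearMap.ext hf).pow_left k) x

lemma killingMap_pow_symm (x y : L) :
    T.B ((T.killingMap ^ k) x) y = T.B x ((T.killingMap ^ k) y) := by
  induction k generalizing x y with
  | zero => rfl
  | succ k ih => rw [pow_succ, Module.End.mul_apply, ih, killingMap_symm, ← Module.End.mul_apply,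
      ← pow_succ', ← pow_succ]

lemma killingMap_pow_lie (x y : L) :
    (T.killingMap ^ k) ⁅x, y⁆ = ⁅x, (T.killingMap ^ k) y⁆ :=
  T.killingMap_pow_commute k (ad ℝ L x) (T.lie_killingMap x) y

/-- The kernel of a power of the Killing map, as an ideal. -/
noncomputable def kerPow : LieIdeal ℝ L :=
  { LinearMap.ker (T.killingMap ^ k) with
    lie_mem := fun {x m} hm ↦ LinearMap.mem_ker.mpr <|
      (T.killingMap_pow_lie k x m).trans ((congrArg _ (LinearMap.mem_ker.mp hm)).trans (lie_zero x)) }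

/-- The range of a power of the Killing map, as an ideal. -/
noncomputable def rangePow : LieIdeal ℝ L :=
  { LinearMap.range (T.killingMap ^ k) with
    lie_mem := by
      rintro x _ ⟨y, rfl⟩
      exact ⟨⁅x, y⁆, T.killingMap_pow_lie k x y⟩ }

lemma mem_kerPow {x : L} : x ∈ T.kerPow k ↔ (T.killingMap ^ k) x = 0 := Iff.rfl

lemma mem_rangePow {x : L} : x ∈ T.rangePow k ↔ ∃ y, (T.killingMap ^ k) y = x := Iff.rfl

end Fitting

/-- For an indecomposable triple, the Fitting decomposition of the Killing map is trivial. -/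
lemma Indecomposable.isNilpotent_or_injective (hindec : T.Indecomposable) :
    IsNilpotent T.killingMap ∨ Function.Injective T.killingMap := by
  obtain ⟨k, hk, hk0⟩ := (T.killingMap.eventually_isCompl_ker_pow_range_pow.and
    (Filter.eventually_ge_atTop 1)).exists
  by_contra! hcon
  refine hindec ⟨T.kerPow k, T.rangePow k, fun h0 ↦ hcon.2 ?_, fun h0 ↦ hcon.1 ⟨k, ?_⟩,
    hk.inf_eq_bot, hk.sup_eq_top, ?_, ?_, ?_, ?_, ?_⟩
  · refine (injective_iff_map_eq_zero _).mpr fun x hx ↦ ?_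
    have hmem : x ∈ T.kerPow k := by
      rw [mem_kerPow, ← Nat.sub_add_cancel hk0, pow_succ, Module.End.mul_apply, hx, map_zero]
    simpa [h0] using hmem
  · ext x
    have hmem : (T.killingMap ^ k) x ∈ T.rangePow k := ⟨x, rfl⟩
    simpa [h0] using hmem
  · rintro x hx _ ⟨z, rfl⟩
    rw [← killingMap_pow_symm, (T.mem_kerPow k).mp hx, map_zero, LinearMap.zero_apply]
  · intro x hx
    rw [mem_kerPow] at hx ⊢
    rw [T.killingMap_pow_commute k _ T.killingMap_theta, hx, map_zero]
  · intro x hx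
    rw [mem_kerPow] at hx ⊢
    rw [T.killingMap_pow_commute k _ T.killingMap_D, hx, map_zero]
  · rintro _ ⟨z, rfl⟩
    exact ⟨T.theta z, T.killingMap_pow_commute k _ T.killingMap_theta z⟩
  · rintro _ ⟨z, rfl⟩
    exact ⟨T.D z, T.killingMap_pow_commute k _ T.killingMap_D z⟩

/-! ### The mean curvature vector -/

lemma D_lie_eq_zero {x y : L} (hx : T.D (T.D x) = -x) (hy : T.D (T.D y) = -y) :
    T.D ⁅x, y⁆ = 0 := by
  have h2 : T.D (T.D ⁅x, y⁆) = (2 : ℝ) • (⁅T.D x, T.D y⁆ - ⁅x, y⁆) := by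
    rw [T.Dder, map_add, T.Dder, T.Dder, hx, hy, neg_lie, lie_neg]
    module
  have h1 : T.D ⁅T.D x, T.D y⁆ = -T.D ⁅x, y⁆ := by
    rw [T.Dder, T.Dder, hx, hy, neg_lie, lie_neg]
    abel
  have h3 := T.D3 ⁅x, y⁆
  rw [h2, map_smul, map_sub, h1] at h3
  have h4 : (2 : ℝ) • (-T.D ⁅x, y⁆ - T.D ⁅x, y⁆) - -T.D ⁅x, y⁆ = (-3 : ℝ) • T.D ⁅x, y⁆ := by module
  rw [sub_eq_zero.mpr h3] at h4
  exact (smul_eq_zero_iff_right (by norm_num)).mp h4.symm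

lemma trace_theta_mul_D_sq_mul_ad_D (η : L) :
    LinearMap.trace ℝ L (T.theta * T.D * T.D * ad ℝ L (T.D η)) = 0 := by
  have hvanish : T.D * T.D * ad ℝ L (T.D η) * (T.D * T.D) = 0 := by
    ext z
    have hz : T.D (T.D (T.D (T.D z))) = -T.D (T.D z) := by rw [T.D3]
    simp [T.D_lie_eq_zero (T.D3 η) hz]
  have hexp : T.theta * T.D * T.D = -(T.D * T.D * (T.theta * (T.D * T.D))) := by
    ext z
    simp [T.Dtheta, T.D3]
  rw [hexp, neg_mul, map_neg, mul_assoc, LinearMap.trace_mul_comm,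
    show T.theta * (T.D * T.D) * ad ℝ L (T.D η) * (T.D * T.D) =
      T.theta * (T.D * T.D * ad ℝ L (T.D η) * (T.D * T.D)) by noncomm_ring,
    hvanish, mul_zero, map_zero, neg_zero]

lemma trace_theta_mul_D_mul_ad (η : L) :
    LinearMap.trace ℝ L (T.theta * T.D * ad ℝ L η) = 0 := by
  have hexp : T.theta * T.D = T.D * (T.theta * T.D * T.D) := by
    ext z
    simp [T.Dtheta, T.D3]
  have hcomm : T.theta * T.D * T.D * ad ℝ L η * T.D =
      -(T.theta * T.D * ad ℝ L η) - T.theta * T.D * T.D * ad ℝ L (T.D η) := by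
    have hswap : ad ℝ L η * T.D = T.D * ad ℝ L η - ad ℝ L (T.D η) := by rw [ad_D, sub_sub_cancel]
    rw [mul_assoc _ (ad ℝ L η), hswap, mul_sub,
      show T.theta * T.D * T.D * (T.D * ad ℝ L η) = T.theta * (T.D * T.D * T.D) * ad ℝ L η by
        noncomm_ring, T.D_cube, mul_neg, neg_mul]
  have hneg : LinearMap.trace ℝ L (T.theta * T.D * ad ℝ L η) =
      -LinearMap.trace ℝ L (T.theta * T.D * ad ℝ L η) := by
    conv_lhs => rw [hexp, mul_assoc, LinearMap.trace_mul_comm, hcomm]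
    rw [map_sub, T.trace_theta_mul_D_sq_mul_ad_D, map_neg, sub_zero]
  linarith

lemma trace_D_mul_ad_lie (x y : L) :
    LinearMap.trace ℝ L (T.D * ad ℝ L ⁅x, y⁆) = killingForm ℝ L (T.D x) y := by
  have had : ad ℝ L ⁅x, y⁆ = ad ℝ L x * ad ℝ L y - ad ℝ L y * ad ℝ L x := by
    ext z
    simp
  rw [killingForm_eq_trace, ad_D, had, mul_sub, sub_mul, map_sub, map_sub, ← mul_assoc,
    ← mul_assoc, LinearMap.trace_mul_comm ℝ (T.D * ad ℝ L y), ← mul_assoc]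

lemma mem_gMinusDown {x : L} :
    x ∈ T.gMinusDown ↔ T.theta x = -x ∧ T.D (T.D x) = -x := by
  simp [gMinusDown, add_eq_zero_iff_eq_neg]

section MeanCurvature

variable {n : ℕ} {e : Fin n → L} {κ : Fin n → ℝ}

lemma sum_form_smul_of_mem_span (horth : ∀ i j, i ≠ j → T.B (e i) (e j) = 0)
    (hκ : ∀ j, T.B (e j) (e j) = κ j) (hκ1 : ∀ j, κ j = 1 ∨ κ j = -1)
    {x : L} (hx : x ∈ Submodule.span ℝ (Set.range e)) :
    ∑ j, (κ j * T.B (e j) x) • e j = x := by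
  induction hx using Submodule.span_induction with
  | mem x hx =>
    obtain ⟨i, rfl⟩ := hx
    rw [Finset.sum_eq_single i, hκ]
    · rcases hκ1 i with hi | hi <;> simp [hi]
    · intro j _ hj
      simp [horth j i hj]
    · simp
  | zero => simp
  | add x y _ _ hx hy =>
    conv_rhs => rw [← hx, ← hy, ← Finset.sum_add_distrib]
    exact Finset.sum_congr rfl fun j _ ↦ by rw [map_add, mul_add, add_smul]
  | smul a x _ hx =>
    conv_rhs => rw [← hx, Finset.smul_sum]
    exact Finset.sum_congr rfl fun j _ ↦ by rw [map_smul, smul_smul, smul_eq_mul, mul_left_comm]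

/-- The sum of the `κⱼ[Deⱼ, eⱼ]` represents half the linear form `η ↦ tr(D ∘ ad η)`. -/
lemma two_mul_form_sum (hmem : ∀ j, e j ∈ T.gMinusDown)
    (hspan : ∀ x ∈ T.gMinusDown, x ∈ Submodule.span ℝ (Set.range e))
    (horth : ∀ i j, i ≠ j → T.B (e i) (e j) = 0)
    (hκ : ∀ j, T.B (e j) (e j) = κ j) (hκ1 : ∀ j, κ j = 1 ∨ κ j = -1) (η : L) :
    2 * T.B (∑ j, κ j • ⁅T.D (e j), e j⁆) η = LinearMap.trace ℝ L (T.D * ad ℝ L η) := by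
  have hexp : T.D * ad ℝ L η - T.theta * T.D * ad ℝ L η =
      ∑ j, ((2 * κ j) • (T.B (e j) ∘ₗ (T.D * ad ℝ L η))).smulRight (e j) := by
    ext x
    set v := T.D ⁅η, x⁆ with hv
    have hvmem : v - T.theta v ∈ T.gMinusDown := by
      refine T.mem_gMinusDown.mpr ⟨by rw [map_sub, T.thetaInvol, neg_sub], ?_⟩
      rw [map_sub, map_sub, T.Dtheta, map_neg, T.Dtheta, hv, T.D3, map_neg]
      abel
    have hform (j : Fin n) : T.B (e j) (v - T.theta v) = 2 * T.B (e j) v := by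
      rw [map_sub, T.form_theta, (T.mem_gMinusDown.mp (hmem j)).1, map_neg, LinearMap.neg_apply]
      ring
    have hsum := T.sum_form_smul_of_mem_span horth hκ hκ1 (hspan _ hvmem)
    simp only [hform] at hsum
    simp only [LinearMap.sub_apply, Module.End.mul_apply, ad_apply, ← hv, LinearMap.sum_apply,
      LinearMap.smulRight_apply, LinearMap.smul_apply, LinearMap.comp_apply, smul_eq_mul]
    rw [← hsum]
    exact Finset.sum_congr rfl fun j _ ↦ by congr 1; ring
  have htrace := congrArg (LinearMap.trace ℝ L) hexp
  rw [map_sub, T.trace_theta_mul_D_mul_ad, sub_zero, map_sum] at htrace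
  rw [htrace, map_sum, LinearMap.sum_apply, Finset.mul_sum]
  refine Finset.sum_congr rfl fun j _ ↦ ?_
  rw [LinearMap.trace_smulRight, map_smul, LinearMap.smul_apply, T.Binv, T.Danti, ← lie_skew,
    map_neg]
  simp [mul_assoc]

lemma lie_sum (hmem : ∀ j, e j ∈ T.gMinusDown)
    (hspan : ∀ x ∈ T.gMinusDown, x ∈ Submodule.span ℝ (Set.range e))
    (horth : ∀ i j, i ≠ j → T.B (e i) (e j) = 0)
    (hκ : ∀ j, T.B (e j) (e j) = κ j) (hκ1 : ∀ j, κ j = 1 ∨ κ j = -1) (x : L) :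
    (2 : ℝ) • ⁅∑ j, κ j • ⁅T.D (e j), e j⁆, x⁆ = T.killingMap (T.D x) := by
  refine T.eq_of_forall_form fun y ↦ ?_
  rw [map_smul, LinearMap.smul_apply, T.Binv, smul_eq_mul,
    T.two_mul_form_sum hmem hspan horth hκ hκ1, T.trace_D_mul_ad_lie, T.form_killingMap]

end MeanCurvature

/-- If `ad h` is a multiple of `φ ∘ D`, then `A_h²` is a multiple of `φ²` on `g₋⁻`. -/
lemma shape_sq {h u : L} {c : ℝ} (hc : ∀ x, ⁅h, x⁆ = c • T.killingMap (T.D x))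
    (hu : u ∈ T.gMinusDown) :
    ⁅T.D ⁅T.D u, h⁆, h⁆ = c ^ 2 • T.killingMap (T.killingMap u) := by
  have hD := (T.mem_gMinusDown.mp hu).2
  rw [← lie_skew _ h, ← lie_skew (T.D u), hc, hc, hD]
  simp only [map_neg, map_smul, smul_neg, neg_neg, ← T.killingMap_D, hD]
  rw [smul_smul, pow_two]

end ExtSymTriple

/-- **Theorem 1.** For an indecomposable extrinsic symmetric triple with `n = dim g₋⁻ ≥ 1`,
mean curvature vector `h` and shape operator `A_h u = -⁅Du, h⁆` on `g₋⁻`, one has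
`A_h ∘ A_h ≠ 0` if and only if `g` is semisimple (its Killing form is nondegenerate).
Note that `A_h (A_h u) = ⁅D ⁅D u, h⁆, h⁆`. -/
theorem shape_sq_ne_zero_iff_semisimple
    {L : Type} [LieRing L] [LieAlgebra ℝ L] [Module.Finite ℝ L]
    (T : ExtSymTriple L) (hindec : T.Indecomposable)
    (n : ℕ) (hn : 1 ≤ n) (hdim : n = Module.finrank ℝ T.gMinusDown)
    (e : Fin n → L) (hmem : ∀ j, e j ∈ T.gMinusDown)
    (hspan : ∀ x ∈ T.gMinusDown, x ∈ Submodule.span ℝ (Set.range e))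
    (horth : ∀ i j, i ≠ j → T.B (e i) (e j) = 0)
    (κ : Fin n → ℝ) (hκ : ∀ j, T.B (e j) (e j) = κ j) (hκ1 : ∀ j, κ j = 1 ∨ κ j = -1)
    (h : L) (hh : h = (n : ℝ)⁻¹ • ∑ j, κ j • ⁅T.D (e j), e j⁆) :
    (∃ u ∈ T.gMinusDown, ⁅T.D ⁅T.D u, h⁆, h⁆ ≠ 0) ↔
      (killingForm ℝ L).Nondegenerate := by
  have hn0 : (n : ℝ) ≠ 0 := by positivity
  have hc (x : L) : ⁅h, x⁆ = (2 * n : ℝ)⁻¹ • T.killingMap (T.D x) := by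
    rw [← T.lie_sum hmem hspan horth hκ hκ1, hh, smul_lie, smul_smul]
    congr 1
    field_simp
  constructor
  · rintro ⟨u, hu, hne⟩
    rcases hindec.isNilpotent_or_injective with hnil | hinj
    · rw [T.shape_sq hc hu, T.killingMap_sq_eq_zero_of_isNilpotent hnil, smul_zero] at hne
      exact absurd rfl hne
    · exact T.killingForm_nondegenerate_of_injective hinj
  · intro hK
    have hinj := T.killingMap_injective hK
    refine ⟨e ⟨0, hn⟩, hmem _, ?_⟩
    rw [T.shape_sq hc (hmem _)]
    refine smul_ne_zero (by positivity) fun h0 ↦ ?_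
    have he : e ⟨0, hn⟩ = 0 := hinj (hinj (by rw [h0, map_zero, map_zero]))
    have hκ0 := hκ ⟨0, hn⟩
    rw [he, map_zero] at hκ0
    rcases hκ1 ⟨0, hn⟩ with h1 | h1 <;> rw [h1] at hκ0 <;> norm_num at hκ0
end

section
/- Let (g, Φ = (D, θ), ⟨·,·⟩) be a weak extrinsic symmetric triple with n = dim g₋⁻ ≥ 1, let h be its mean curvature vector and A_h the associated shape operator on g₋⁻. Then for all u, v ∈ g₋⁻ one has B_g(u,v) = −2n·⟨A_h(u), v⟩ and B_g(u,v) = B_g(Du, Dv), where B_g(x,y) = tr(ad x ∘ ad y) is the Killing form of g. -/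
/-- A weak extrinsic symmetric triple: the invariant symmetric bilinear form may be
degenerate, but its radical must be contained in `g₋⁺` (so the form is nondegenerate on
`g₋⁻`). -/
structure WeakExtSymTriple (L : Type) [LieRing L] [LieAlgebra ℝ L] [Module.Finite ℝ L] where
  B : LinearMap.BilinForm ℝ L
  Bsymm : ∀ x y, B x y = B y x
  Binv : ∀ x y z, B ⁅x, y⁆ z = B x ⁅y, z⁆
  theta : L →ₗ[ℝ] L
  thetaLie : ∀ x y, theta ⁅x, y⁆ = ⁅theta x, theta y⁆
  thetaInvol : ∀ x, theta (theta x) = x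
  thetaIso : ∀ x y, B (theta x) (theta y) = B x y
  D : L →ₗ[ℝ] L
  Dder : ∀ x y, D ⁅x, y⁆ = ⁅D x, y⁆ + ⁅x, D y⁆
  Danti : ∀ x y, B (D x) y = - B x (D y)
  D3 : ∀ x, D (D (D x)) = - D x
  Dtheta : ∀ x, D (theta x) = - theta (D x)
  cartan : (LinearMap.ker (theta - LinearMap.id) ⊓ LinearMap.ker D) =
    bracketSpan
      (LinearMap.ker (theta - LinearMap.id) ⊓ LinearMap.ker (D ∘ₗ D + LinearMap.id))
      (LinearMap.ker (theta - LinearMap.id) ⊓ LinearMap.ker (D ∘ₗ D + LinearMap.id))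
  radicalLe : ∀ x, (∀ y, B x y = 0) →
    x ∈ (LinearMap.ker (theta + LinearMap.id) ⊓ LinearMap.ker D)

namespace WeakExtSymTriple

variable {L : Type} [LieRing L] [LieAlgebra ℝ L] [Module.Finite ℝ L] (T : WeakExtSymTriple L)

/-- `g₊⁺ = g₊ ∩ g⁺`. -/
def gPlusUp : Submodule ℝ L :=
  LinearMap.ker (T.theta - LinearMap.id) ⊓ LinearMap.ker T.D

/-- `g₊⁻ = g₊ ∩ g⁻`. -/
def gPlusDown : Submodule ℝ L :=
  LinearMap.ker (T.theta - LinearMap.id) ⊓ LinearMap.ker (T.D ∘ₗ T.D + LinearMap.id)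

/-- `g₋⁺ = g₋ ∩ g⁺`. -/
def gMinusUp : Submodule ℝ L :=
  LinearMap.ker (T.theta + LinearMap.id) ⊓ LinearMap.ker T.D

/-- `g₋⁻ = g₋ ∩ g⁻`. -/
def gMinusDown : Submodule ℝ L :=
  LinearMap.ker (T.theta + LinearMap.id) ⊓ LinearMap.ker (T.D ∘ₗ T.D + LinearMap.id)

end WeakExtSymTriple

namespace WeakExtSymTriple

variable {L : Type} [LieRing L] [LieAlgebra ℝ L] [Module.Finite ℝ L] (T : WeakExtSymTriple L)

lemma mem_gMinusDown {x : L} : x ∈ T.gMinusDown ↔ T.theta x = -x ∧ T.D (T.D x) = -x := by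
  simp [gMinusDown, add_eq_zero_iff_eq_neg]

/-- `[g⁻, g⁻] ⊆ g⁺`. -/
lemma D_lie_eq_zero {v w : L} (hv : T.D (T.D v) = -v) (hw : T.D (T.D w) = -w) :
    T.D ⁅v, w⁆ = 0 := by
  have hs : T.D (T.D ⁅v, w⁆) = (2 : ℝ) • (⁅T.D v, T.D w⁆ - ⁅v, w⁆) := by
    simp only [T.Dder, map_add, hv, hw, neg_lie, lie_neg]
    module
  have ht : T.D (T.D ⁅T.D v, T.D w⁆) = (2 : ℝ) • (⁅v, w⁆ - ⁅T.D v, T.D w⁆) := by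
    simp only [T.Dder, map_add, hv, hw, neg_lie, lie_neg, map_neg]
    module
  have h4 := T.D3 (T.D ⁅v, w⁆)
  rw [hs, map_smul, map_smul, map_sub, map_sub, hs, ht] at h4
  have hst : ⁅T.D v, T.D w⁆ = ⁅v, w⁆ := by
    linear_combination (norm := module) (-(1 / 6 : ℝ)) • h4
  rw [hst, sub_self, smul_zero] at hs
  have h3 := T.D3 ⁅v, w⁆
  rw [hs, map_zero] at h3
  exact neg_eq_zero.mp h3.symm

lemma lie_D_right {v w : L} (hv : T.D (T.D v) = -v) (hw : T.D (T.D w) = -w) :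
    ⁅v, T.D w⁆ = -⁅T.D v, w⁆ := by
  have := T.D_lie_eq_zero hv hw
  rw [T.Dder] at this
  exact (neg_eq_of_add_eq_zero_right this).symm

lemma lie_D_D {v w : L} (hv : T.D (T.D v) = -v) (hw : T.D (T.D w) = -w) :
    ⁅T.D v, T.D w⁆ = ⁅v, w⁆ := by
  rw [T.lie_D_right (by rw [hv, map_neg]) hw, hv, neg_lie, neg_neg]

/-- `ad v` exchanges `g⁺` and `g⁻` for `v ∈ g⁻`. -/
lemma ad_mul_D_sq {v : L} (hv : T.D (T.D v) = -v) :
    LieAlgebra.ad ℝ L v * (T.D * T.D) = -((1 + T.D * T.D) * LieAlgebra.ad ℝ L v) := by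
  ext z
  have h1 : ⁅T.D v, T.D z⁆ = -⁅v, T.D (T.D z)⁆ := by
    rw [T.lie_D_right hv (T.D3 z), neg_neg]
  simp only [Module.End.mul_apply, LieAlgebra.ad_apply, LinearMap.neg_apply,
    LinearMap.add_apply, Module.End.one_apply, T.Dder, map_add, hv, h1, neg_lie]
  abel

lemma ad_D (x : L) :
    LieAlgebra.ad ℝ L (T.D x) = T.D * LieAlgebra.ad ℝ L x - LieAlgebra.ad ℝ L x * T.D := by
  ext z
  simp [T.Dder]

lemma killingForm_D_left (x y : L) :
    killingForm ℝ L (T.D x) y = -killingForm ℝ L x (T.D y) := by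
  simp only [killingForm_apply_apply, ← Module.End.mul_eq_comp, ad_D, sub_mul, mul_sub, map_sub]
  rw [mul_assoc, LinearMap.trace_mul_comm ℝ T.D, mul_assoc, mul_assoc]
  ring

lemma killingForm_eq_trace_D_sq {u : L} (hu : T.D (T.D u) = -u) (v : L) :
    killingForm ℝ L u v =
      LinearMap.trace ℝ L (LieAlgebra.ad ℝ L u * LieAlgebra.ad ℝ L v * -(T.D * T.D)) +
      LinearMap.trace ℝ L (LieAlgebra.ad ℝ L v * LieAlgebra.ad ℝ L u * -(T.D * T.D)) := by
  have h2 : LinearMap.trace ℝ L (LieAlgebra.ad ℝ L v * LieAlgebra.ad ℝ L u * -(T.D * T.D)) =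
      LinearMap.trace ℝ L (LieAlgebra.ad ℝ L u * LieAlgebra.ad ℝ L v * (1 + T.D * T.D)) := by
    rw [mul_assoc, mul_neg, T.ad_mul_D_sq hu, neg_neg,
      ← mul_assoc, LinearMap.trace_mul_comm, ← mul_assoc]
  rw [h2, ← map_add, ← mul_add, neg_add_cancel_comm_assoc, mul_one]
  rfl

lemma B_lie_lie (x y z w : L) : T.B ⁅x, ⁅y, z⁆⁆ w = -T.B ⁅y, z⁆ ⁅x, w⁆ := by
  rw [← lie_skew, map_neg, LinearMap.neg_apply, T.Binv]

lemma B_D_D_of_D_sq {x : L} (hx : T.D (T.D x) = -x) (y : L) : T.B (T.D y) (T.D x) = T.B y x := by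
  rw [T.Danti, hx, map_neg, neg_neg]

lemma B_eq_zero_of_theta {x y : L} (hx : T.theta x = -x) (hy : T.theta y = y) : T.B x y = 0 := by
  have := T.thetaIso x y
  rw [hx, hy, map_neg, LinearMap.neg_apply] at this
  linarith

variable {n : ℕ} {e : Fin n → L} {κ : Fin n → ℝ}

lemma sum_smul_B_eq_of_mem_span (horth : ∀ i j, i ≠ j → T.B (e i) (e j) = 0)
    (hκ : ∀ j, T.B (e j) (e j) = κ j) (hκ1 : ∀ j, κ j = 1 ∨ κ j = -1) {x : L}
    (hx : x ∈ Submodule.span ℝ (Set.range e)) : ∑ j, (κ j * T.B x (e j)) • e j = x := by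
  induction hx using Submodule.span_induction with
  | mem x hx =>
    obtain ⟨i, rfl⟩ := hx
    rw [Finset.sum_eq_single i (fun j _ hj => by rw [horth i j hj.symm, mul_zero, zero_smul])
      (by simp), hκ]
    rcases hκ1 i with h | h <;> simp [h]
  | zero => simp
  | add x y _ _ hx hy =>
    simp only [map_add, LinearMap.add_apply, mul_add, add_smul, Finset.sum_add_distrib, hx, hy]
  | smul c x _ hx =>
    conv_rhs => rw [← hx, Finset.smul_sum]
    simp only [map_smul, LinearMap.smul_apply, smul_smul, smul_eq_mul]
    exact Finset.sum_congr rfl fun j _ => by ring_nf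

/-- Expansion of the projection `-D²` onto `g⁻` in the orthonormal basis `e`, `D e`. -/
lemma neg_D_sq_eq_sum (hmem : ∀ j, e j ∈ T.gMinusDown)
    (hspan : ∀ x ∈ T.gMinusDown, x ∈ Submodule.span ℝ (Set.range e))
    (horth : ∀ i j, i ≠ j → T.B (e i) (e j) = 0)
    (hκ : ∀ j, T.B (e j) (e j) = κ j) (hκ1 : ∀ j, κ j = 1 ∨ κ j = -1) :
    -(T.D * T.D) = ∑ j, κ j • ((T.B (e j)).smulRight (e j) +
      (T.B (T.D (e j))).smulRight (T.D (e j))) := by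
  have he := fun j => T.mem_gMinusDown.1 (hmem j)
  have hexp : ∀ x ∈ T.gMinusDown, ∑ j, (κ j * T.B x (e j)) • e j = x := fun x hx =>
    T.sum_smul_B_eq_of_mem_span horth hκ hκ1 (hspan x hx)
  ext z
  set a : L := (1 / 2 : ℝ) • (T.theta (T.D (T.D z)) - T.D (T.D z)) with ha
  set b : L := -(1 / 2 : ℝ) • (T.D z - T.theta (T.D z)) with hb
  have hDth : ∀ x, T.theta (T.D x) = -T.D (T.theta x) := fun x => by rw [T.Dtheta, neg_neg]
  have ham : a ∈ T.gMinusDown := by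
    rw [mem_gMinusDown]
    constructor
    · rw [ha, map_smul, map_sub, T.thetaInvol]; module
    · simp only [ha, map_smul, map_sub, T.Dtheta, T.D3, map_neg]; module
  have hbm : b ∈ T.gMinusDown := by
    rw [mem_gMinusDown]
    constructor
    · rw [hb, map_smul, map_sub, T.thetaInvol]; module
    · simp only [hb, map_smul, map_sub, T.Dtheta, T.D3, map_neg]; module
  have hab : -T.D (T.D z) = a + T.D b := by
    simp only [ha, hb, map_smul, map_sub, T.Dtheta]; module
  have hz : ∀ x, T.D (T.D x) = -x → T.B x z = T.B a x + T.B (T.D b) x := fun x hx => by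
    rw [← LinearMap.add_apply, ← map_add, ← hab, map_neg, LinearMap.neg_apply, T.Danti, T.Danti,
      hx, map_neg, T.Bsymm]
    ring
  have hae : ∀ j, T.B a (T.D (e j)) = 0 := fun j =>
    T.B_eq_zero_of_theta (T.mem_gMinusDown.1 ham).1 (by rw [hDth, (he j).1, map_neg, neg_neg])
  have hbe : ∀ j, T.B (T.D b) (e j) = 0 := fun j => by
    rw [T.Bsymm]
    exact T.B_eq_zero_of_theta (he j).1
      (by rw [hDth, (T.mem_gMinusDown.1 hbm).1, map_neg, neg_neg])
  have hze : ∀ j, T.B (e j) z = T.B a (e j) := fun j => by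
    rw [hz _ (he j).2, hbe, add_zero]
  have hzDe : ∀ j, T.B (T.D (e j)) z = T.B b (e j) := fun j => by
    rw [hz _ (T.D3 _), hae, zero_add, T.B_D_D_of_D_sq (he j).2]
  have hsum := congrArg₂ (· + ·) (hexp a ham) (congrArg T.D (hexp b hbm))
  simp only [map_sum, map_smul, ← Finset.sum_add_distrib] at hsum
  simp only [LinearMap.neg_apply, Module.End.mul_apply, LinearMap.sum_apply, LinearMap.smul_apply,
    LinearMap.add_apply, LinearMap.smulRight_apply, hze, hzDe, smul_add, smul_smul]
  rw [hab, hsum]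

lemma trace_mul_neg_D_sq (hmem : ∀ j, e j ∈ T.gMinusDown)
    (hspan : ∀ x ∈ T.gMinusDown, x ∈ Submodule.span ℝ (Set.range e))
    (horth : ∀ i j, i ≠ j → T.B (e i) (e j) = 0)
    (hκ : ∀ j, T.B (e j) (e j) = κ j) (hκ1 : ∀ j, κ j = 1 ∨ κ j = -1) (A : Module.End ℝ L) :
    LinearMap.trace ℝ L (A * -(T.D * T.D)) =
      ∑ j, κ j * (T.B (e j) (A (e j)) + T.B (T.D (e j)) (A (T.D (e j)))) := by
  have hone : ∀ (f : L →ₗ[ℝ] ℝ) (x : L),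
      LinearMap.trace ℝ L (A * f.smulRight x) = f (A x) := fun f x => by
    have : A * f.smulRight x = f.smulRight (A x) := by ext z; simp
    rw [this, LinearMap.trace_smulRight]
  rw [T.neg_D_sq_eq_sum hmem hspan horth hκ hκ1, Finset.mul_sum, map_sum]
  simp only [mul_smul_comm, mul_add, map_smul, map_add, hone, smul_eq_mul]

/-- The Gauss-type identity relating the shape operator pairing to the brackets. -/
lemma B_lie_lie_add_B_lie_lie {u v x : L} (hu : T.D (T.D u) = -u) (hx : T.D (T.D x) = -x) :
    T.B ⁅v, x⁆ ⁅u, x⁆ + T.B ⁅v, T.D x⁆ ⁅u, T.D x⁆ = T.B ⁅T.D x, x⁆ ⁅T.D u, v⁆ := by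
  have h1 : T.B (T.D x) ⁅T.D u, ⁅x, v⁆⁆ = T.B ⁅v, x⁆ ⁅u, x⁆ := by
    rw [← T.Binv, T.lie_D_D hx hu, T.Bsymm, ← lie_skew v x, ← lie_skew u x, map_neg, map_neg,
      LinearMap.neg_apply, neg_neg]
  have h2 : T.B (T.D x) ⁅⁅x, T.D u⁆, v⁆ = T.B ⁅v, T.D x⁆ ⁅u, T.D x⁆ := by
    rw [T.lie_D_right hx hu, ← lie_skew u, ← lie_skew v (T.D x), neg_lie, lie_skew v,
      map_neg, map_neg, LinearMap.neg_apply, neg_neg, ← T.Binv]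
  rw [T.Binv (T.D x) x, leibniz_lie x (T.D u), map_add, h1, h2, add_comm]

end WeakExtSymTriple

/-- **Lemma 1 (Eschenburg–Kim).** For a weak extrinsic symmetric triple with mean
curvature vector `h` and shape operator `A_h u = -⁅Du, h⁆`, one has
`B_g(u,v) = -2n ⟨A_h u, v⟩` and `B_g(u,v) = B_g(Du, Dv)` for all `u, v ∈ g₋⁻`. -/
theorem killing_eq_shape_pairing
    {L : Type} [LieRing L] [LieAlgebra ℝ L] [Module.Finite ℝ L]
    (T : WeakExtSymTriple L)
    (n : ℕ) (hn : 1 ≤ n) (hdim : n = Module.finrank ℝ T.gMinusDown)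
    (e : Fin n → L) (hmem : ∀ j, e j ∈ T.gMinusDown)
    (hspan : ∀ x ∈ T.gMinusDown, x ∈ Submodule.span ℝ (Set.range e))
    (horth : ∀ i j, i ≠ j → T.B (e i) (e j) = 0)
    (κ : Fin n → ℝ) (hκ : ∀ j, T.B (e j) (e j) = κ j) (hκ1 : ∀ j, κ j = 1 ∨ κ j = -1)
    (h : L) (hh : h = (n : ℝ)⁻¹ • ∑ j, κ j • ⁅T.D (e j), e j⁆) :
    ∀ u ∈ T.gMinusDown, ∀ v ∈ T.gMinusDown,
      killingForm ℝ L u v = -(2 * (n : ℝ)) * T.B (-⁅T.D u, h⁆) v ∧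
      killingForm ℝ L u v = killingForm ℝ L (T.D u) (T.D v) := by
  intro u hu v hv
  have hu2 := (T.mem_gMinusDown.1 hu).2
  have hv2 := (T.mem_gMinusDown.1 hv).2
  refine ⟨?_, by rw [T.killingForm_D_left, hv2, map_neg, neg_neg]⟩
  have hn0 : (n : ℝ) ≠ 0 := by positivity
  have hRHS : -(2 * (n : ℝ)) * T.B (-⁅T.D u, h⁆) v =
      ∑ j, -(2 * (κ j * T.B ⁅T.D (e j), e j⁆ ⁅T.D u, v⁆)) := by
    have hBh : T.B h ⁅T.D u, v⁆ = (n : ℝ)⁻¹ * ∑ j, κ j * T.B ⁅T.D (e j), e j⁆ ⁅T.D u, v⁆ := by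
      simp [hh, LinearMap.sum_apply]
    rw [lie_skew, T.Binv, hBh, Finset.sum_neg_distrib, ← Finset.mul_sum]
    field_simp
  have hB : ∀ a b x : L, T.B x ⁅a, ⁅b, x⁆⁆ = -T.B ⁅b, x⁆ ⁅a, x⁆ := fun a b x => by
    rw [T.Bsymm, T.B_lie_lie]
  rw [hRHS, T.killingForm_eq_trace_D_sq hu2 v,
    T.trace_mul_neg_D_sq hmem hspan horth hκ hκ1, T.trace_mul_neg_D_sq hmem hspan horth hκ hκ1,
    ← Finset.sum_add_distrib]
  refine Finset.sum_congr rfl fun j _ => ?_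
  rw [← T.B_lie_lie_add_B_lie_lie hu2 (T.mem_gMinusDown.1 (hmem j)).2]
  simp only [Module.End.mul_apply, LieAlgebra.ad_apply, hB]
  rw [T.Bsymm ⁅u, e j⁆, T.Bsymm ⁅u, T.D (e j)⁆]
  ring
end

section
/- Let g be a finite-dimensional real Lie algebra and let τ be an involutive Lie algebra automorphism of g with (+1)-eigenspace g⁺ and (−1)-eigenspace g⁻. Suppose that the restriction of the Killing form B_g(x,y) = tr(ad x ∘ ad y) to g⁻ is nondegenerate and that [g⁻, g⁻] = g⁺. Then the Killing form of g is nondegenerate; in particular, g is semisimple. -/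
/-- If the kernel of the Killing form is central, then `φ ∘ ⁅·, ·⁆` is of the form
`killingForm (D ·) ·` for some linear endomorphism `D`. -/
lemma exists_killingForm_apply_eq_dual_lie {K L : Type*} [Field K] [LieRing L] [LieAlgebra K L]
    [Module.Finite K L]
    (h : ∀ x ∈ LinearMap.ker (killingForm K L), ∀ y : L, ⁅x, y⁆ = 0) (φ : Module.Dual K L) :
    ∃ D : L →ₗ[K] L, ∀ x y, killingForm K L (D x) y = φ ⁅x, y⁆ := by
  let ω : L →ₗ[K] Module.Dual K L := (LieModule.toEnd K L L : L →ₗ[K] Module.End K L).compr₂ φ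
  have hω : ∀ x, ω x ∈ LinearMap.range (killingForm K L) := fun x ↦ by
    have hx : ω x ∈ (LinearMap.ker (killingForm K L)).dualAnnihilator := by
      refine (Submodule.mem_dualAnnihilator _).mpr fun y hy ↦ ?_
      change φ ⁅x, y⁆ = 0
      rw [← lie_skew, h y hy, neg_zero, map_zero]
    rw [← LinearMap.range_dualMap_eq_dualAnnihilator_ker] at hx
    obtain ⟨ξ, hξ⟩ := hx
    obtain ⟨v, rfl⟩ := (Module.evalEquiv K L).surjective ξ
    refine ⟨v, LinearMap.ext fun y ↦ ?_⟩
    rw [← hξ, LieModule.traceForm_comm]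
    rfl
  obtain ⟨D, hD⟩ := Module.projective_lifting_property (killingForm K L).rangeRestrict
    (ω.codRestrict _ hω) (killingForm K L).surjective_rangeRestrict
  refine ⟨D, fun x y ↦ ?_⟩
  exact LinearMap.congr_fun (congrArg Subtype.val (LinearMap.congr_fun hD x)) y

/-- If the kernel of the Killing form is central, then it meets the span of all brackets
trivially. -/
lemma eq_zero_of_mem_ker_killingForm_of_mem_span_lie {K L : Type*} [Field K] [LieRing L]
    [LieAlgebra K L] [Module.Finite K L]
    (h : ∀ x ∈ LinearMap.ker (killingForm K L), ∀ y : L, ⁅x, y⁆ = 0) {w : L}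
    (hw : w ∈ LinearMap.ker (killingForm K L))
    (hw' : w ∈ Submodule.span K {z | ∃ u v : L, z = ⁅u, v⁆}) : w = 0 := by
  refine (Module.forall_dual_apply_eq_zero_iff K w).mp fun φ ↦ ?_
  obtain ⟨D, hD⟩ := exists_killingForm_apply_eq_dual_lie h φ
  have hinv : ∀ x y z : L, killingForm K L ⁅x, y⁆ z = killingForm K L x ⁅y, z⁆ :=
    LieModule.traceForm_apply_lie_apply K L L
  have hder : ∀ x y : L, D ⁅x, y⁆ - ⁅D x, y⁆ - ⁅x, D y⁆ ∈ LinearMap.ker (killingForm K L) := by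
    refine fun x y ↦ LinearMap.mem_ker.mpr (LinearMap.ext fun z ↦ ?_)
    have hxy : killingForm K L ⁅x, D y⁆ z = -φ ⁅y, ⁅x, z⁆⁆ := by
      rw [← lie_skew, map_neg, LinearMap.neg_apply, hinv, hD]
    simp only [map_sub, LinearMap.sub_apply, LinearMap.zero_apply, hxy, hinv, hD,
      lie_lie x y z]
    ring
  let ψ : Module.Dual K L :=
    (LinearMap.trace K L) ∘ₗ (LinearMap.mulLeft K D) ∘ₗ (LieAlgebra.ad K L : L →ₗ[K] Module.End K L)
  have hψ : ∀ x, ψ x = LinearMap.trace K L (D * LieAlgebra.ad K L x) := fun _ ↦ rfl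
  have hbr : ∀ x y : L, ψ ⁅x, y⁆ = φ ⁅x, y⁆ := fun x y ↦ by
    set X := LieAlgebra.ad K L x with hX
    set Y := LieAlgebra.ad K L y with hY
    set k : Module.End K L := D * X - X * D - LieAlgebra.ad K L (D x) with hk
    have hYk : Y * k = 0 := LinearMap.ext fun z ↦ by
      have : k z = D ⁅x, z⁆ - ⁅D x, z⁆ - ⁅x, D z⁆ := by
        simp only [hk, hX, LinearMap.sub_apply, Module.End.mul_apply, LieAlgebra.ad_apply]
        abel
      rw [Module.End.mul_apply, this, hY, LieAlgebra.ad_apply, ← lie_skew, h _ (hder x z),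
        neg_zero, LinearMap.zero_apply]
    have hkY : LinearMap.trace K L (k * Y) = 0 := by
      rw [LinearMap.trace_mul_comm, hYk, map_zero]
    have hB : LinearMap.trace K L (LieAlgebra.ad K L (D x) * Y) = φ ⁅x, y⁆ := hD x y
    have hcyc : LinearMap.trace K L (D * Y * X) = LinearMap.trace K L (X * D * Y) := by
      rw [LinearMap.trace_mul_comm, mul_assoc]
    have had : LieAlgebra.ad K L ⁅x, y⁆ = X * Y - Y * X := LinearMap.ext fun z ↦ lie_lie x y z
    rw [hψ, had, mul_sub, map_sub, ← mul_assoc, ← mul_assoc, hcyc, ← hB]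
    rw [hk, sub_mul, sub_mul, map_sub, map_sub] at hkY
    exact sub_eq_zero.mp hkY
  have hφψ : φ w = ψ w := by
    refine LinearMap.eqOn_span (f := φ) (g := ψ) ?_ hw'
    rintro _ ⟨u, v, rfl⟩
    exact (hbr u v).symm
  have hadw : LieAlgebra.ad K L w = 0 := LinearMap.ext (h w hw)
  rw [hφψ, hψ, hadw, mul_zero, map_zero]

/-- Let `τ` be an involutive automorphism of a finite-dimensional real Lie algebra `g` with
eigenspaces `g⁺ = ker(τ - id)` and `g⁻ = ker(τ + id)`. If the Killing form restricted to
`g⁻` is nondegenerate and `[g⁻, g⁻] = g⁺`, then the Killing form of `g` is nondegenerate,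
i.e. `g` is semisimple. -/
theorem killingForm_nondegenerate_of_involution
    {L : Type} [LieRing L] [LieAlgebra ℝ L] [Module.Finite ℝ L]
    (τ : L →ₗ[ℝ] L) (hτLie : ∀ x y, τ ⁅x, y⁆ = ⁅τ x, τ y⁆) (hτinv : ∀ x, τ (τ x) = x)
    (hnd : ∀ x ∈ LinearMap.ker (τ + LinearMap.id),
      (∀ y ∈ LinearMap.ker (τ + LinearMap.id), killingForm ℝ L x y = 0) → x = 0)
    (hbr : bracketSpan (LinearMap.ker (τ + LinearMap.id)) (LinearMap.ker (τ + LinearMap.id))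
      = LinearMap.ker (τ - LinearMap.id)) :
    (killingForm ℝ L).Nondegenerate := by
  have hpos : ∀ {x}, x ∈ LinearMap.ker (τ - LinearMap.id) ↔ τ x = x := by
    simp [sub_eq_zero]
  have hneg : ∀ {x}, x ∈ LinearMap.ker (τ + LinearMap.id) ↔ τ x = -x := by
    simp [add_eq_zero_iff_eq_neg]
  let e : L ≃ₗ⁅ℝ⁆ L :=
    { LinearEquiv.ofInvolutive τ hτinv with map_lie' := hτLie _ _ }
  have hinvariant : ∀ x y, killingForm ℝ L (τ x) (τ y) = killingForm ℝ L x y := fun x y ↦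
    LieAlgebra.killingForm_of_equiv_apply e x y
  have hlie : ∀ {x} (y : L), x ∈ LinearMap.ker (killingForm ℝ L) →
      ⁅x, y⁆ ∈ LinearMap.ker (killingForm ℝ L) := fun {x} y hx ↦ by
    refine LinearMap.mem_ker.mpr (LinearMap.ext fun z ↦ ?_)
    rw [LieModule.traceForm_apply_lie_apply, LinearMap.mem_ker.mp hx]
    rfl
  have hker_neg : ∀ {x}, x ∈ LinearMap.ker (killingForm ℝ L) → τ x = -x → x = 0 :=
    fun {x} hx hx' ↦ hnd x (hneg.mpr hx') fun y _ ↦ by rw [LinearMap.mem_ker.mp hx]; rfl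
  have hker_pos : ∀ {x}, x ∈ LinearMap.ker (killingForm ℝ L) → τ x = x := fun {x} hx ↦ by
    have hτx : τ x ∈ LinearMap.ker (killingForm ℝ L) :=
      LinearMap.mem_ker.mpr (LinearMap.ext fun z ↦ by
        rw [← hτinv z, hinvariant, LinearMap.mem_ker.mp hx]; rfl)
    refine sub_eq_zero.mp (hker_neg (sub_mem hτx hx) ?_)
    rw [map_sub, hτinv, neg_sub]
  have hcomm_neg : ∀ {x y}, x ∈ LinearMap.ker (killingForm ℝ L) → τ y = -y → ⁅x, y⁆ = 0 :=
    fun {x y} hx hy ↦ hker_neg (hlie y hx) (by rw [hτLie, hker_pos hx, hy, lie_neg])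
  have hcomm_pos : ∀ {x y}, x ∈ LinearMap.ker (killingForm ℝ L) → τ y = y → ⁅x, y⁆ = 0 :=
      fun {x y} hx hy ↦ by
    have hy' := hpos.mpr hy
    rw [← hbr] at hy'
    refine Submodule.span_induction ?_ (lie_zero x) ?_ ?_ hy'
    · rintro _ ⟨u, hu, v, hv, rfl⟩
      rw [leibniz_lie, hcomm_neg hx (hneg.mp hu), hcomm_neg hx (hneg.mp hv), zero_lie, lie_zero,
        add_zero]
    · intro a b _ _ ha hb
      rw [lie_add, ha, hb, add_zero]
    · intro c a _ ha
      rw [lie_smul, ha, smul_zero]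
  have hcentral : ∀ x ∈ LinearMap.ker (killingForm ℝ L), ∀ y : L, ⁅x, y⁆ = 0 := fun x hx y ↦ by
    have h₁ : ⁅x, y + τ y⁆ = 0 := hcomm_pos hx (by rw [map_add, hτinv, add_comm])
    have h₂ : ⁅x, y - τ y⁆ = 0 := hcomm_neg hx (by rw [map_sub, hτinv, neg_sub])
    have h₃ : (2 : ℝ) • ⁅x, y⁆ = 0 := by
      rw [two_smul, ← lie_add, show y + y = (y + τ y) + (y - τ y) by abel, lie_add, h₁, h₂,
        add_zero]
    exact (smul_eq_zero.mp h₃).resolve_left two_ne_zero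
  have hker : LinearMap.ker (killingForm ℝ L) = ⊥ := by
    refine (Submodule.eq_bot_iff _).mpr fun x hx ↦
      eq_zero_of_mem_ker_killingForm_of_mem_span_lie hcentral hx ?_
    have hx' := hpos.mpr (hker_pos hx)
    rw [← hbr] at hx'
    refine Submodule.span_mono ?_ hx'
    rintro _ ⟨u, _, v, _, rfl⟩
    exact ⟨u, v, rfl⟩
  exact (LieModule.traceForm_isSymm ℝ L L).isRefl.nondegenerate_iff_separatingLeft.mpr
    (LinearMap.separatingLeft_iff_ker_eq_bot.mpr hker)
end

section
/- Let g be a finite-dimensional real Lie algebra, let θ be an involutive Lie algebra automorphism of g, and let D be a derivation of g with D³ = −D and D∘θ = −θ∘D. Then for all u, v ∈ g with θ(u) = −u, θ(v) = −v, D²(u) = −u and D²(v) = −v, one has [Du, Dv] = [u, v]. -/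
/-- Let `θ` be an involutive automorphism of a finite-dimensional real Lie algebra `g` and
`D` a derivation with `D³ = -D` and `D ∘ θ = -θ ∘ D`. Then for all `u, v` in the
intersection of the `(-1)`-eigenspace of `θ` with the `(-1)`-eigenspace of `D²`, one has
`⁅Du, Dv⁆ = ⁅u, v⁆`. -/
theorem bracket_D_eq_bracket
    {L : Type} [LieRing L] [LieAlgebra ℝ L] [Module.Finite ℝ L]
    (θ : L →ₗ[ℝ] L) (hθLie : ∀ x y, θ ⁅x, y⁆ = ⁅θ x, θ y⁆) (hθinv : ∀ x, θ (θ x) = x)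
    (D : L →ₗ[ℝ] L) (hDder : ∀ x y, D ⁅x, y⁆ = ⁅D x, y⁆ + ⁅x, D y⁆)
    (hD3 : ∀ x, D (D (D x)) = - D x)
    (hDθ : ∀ x, D (θ x) = - θ (D x))
    (u v : L) (hu : θ u = -u) (hv : θ v = -v)
    (hu2 : D (D u) = -u) (hv2 : D (D v) = -v) :
    ⁅D u, D v⁆ = ⁅u, v⁆ := by
  have h1 := hDder u v
  have h2 : D (D ⁅u, v⁆) = (2 : ℝ) • (⁅D u, D v⁆ - ⁅u, v⁆) := by
    rw [h1, map_add, hDder, hDder, hu2, hv2, neg_lie, lie_neg]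
    module
  have h3 : D (D (D ⁅u, v⁆)) = (-4 : ℝ) • D ⁅u, v⁆ := by
    rw [h2, map_smul, map_sub, hDder (D u), h1, hu2, hv2, neg_lie, lie_neg]
    module
  have h4 : D ⁅u, v⁆ = 0 := by
    have h : (3 : ℝ) • D ⁅u, v⁆ = 0 := by
      rw [hD3] at h3
      linear_combination (norm := module) h3
    exact (smul_eq_zero.mp h).resolve_left (by norm_num)
  rw [h4, map_zero] at h2
  exact sub_eq_zero.mp ((smul_eq_zero.mp h2.symm).resolve_left (by norm_num))
end

section
/- Let (g, Φ = (D, θ), ⟨·,·⟩) be an extrinsic symmetric triple such that g is semisimple (its Killing form is nondegenerate). Then there exists a unique ξ ∈ g with D = ad ξ, and this ξ satisfies θ(ξ) = −ξ and D(ξ) = 0; that is, ξ ∈ g₋⁺, so the triple is of Ferus type. -/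
/-- If `g` is semisimple (its Killing form is nondegenerate), then the derivation `D` of an
extrinsic symmetric triple is inner, `D = ad ξ` for a unique `ξ`, and this `ξ` satisfies
`θ ξ = -ξ` and `D ξ = 0`, i.e. `ξ ∈ g₋⁺`; so the triple is of Ferus type. -/
theorem ferusType_of_semisimple
    {L : Type} [LieRing L] [LieAlgebra ℝ L] [Module.Finite ℝ L]
    (T : ExtSymTriple L)
    (hss : (killingForm ℝ L).Nondegenerate) :
    (∃! ξ : L, ∀ x, T.D x = ⁅ξ, x⁆) ∧
      ∀ ξ : L, (∀ x, T.D x = ⁅ξ, x⁆) → T.theta ξ = -ξ ∧ T.D ξ = 0 := by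
  have : LieAlgebra.IsKilling ℝ L := ⟨
    (LieSubmodule.eq_bot_iff _).mpr fun x hx ↦ hss.2 x fun y ↦ by
      simpa using LieIdeal.mem_killingCompl ℝ L ⊤ |>.mp hx y⟩
  have ad_inj : ∀ ξ η : L, (∀ x : L, ⁅ξ, x⁆ = ⁅η, x⁆) → ξ = η := by
    intro ξ η h
    rw [← sub_eq_zero, ← LieDerivation.IsKilling.ad_apply_eq_zero_iff ℝ]
    ext x
    simp [h x]
  have exists_ad : ∃ ξ : L, ∀ x, T.D x = ⁅ξ, x⁆ := by
    obtain ⟨ξ, hξ⟩ := LieDerivation.IsKilling.exists_eq_ad (R := ℝ)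
      (⟨T.D, fun a b ↦ by rw [T.Dder, ← lie_skew b, add_comm, sub_neg_eq_add]⟩ :
        LieDerivation ℝ L L)
    exact ⟨ξ, fun x ↦ by simpa using (DFunLike.congr_fun hξ x).symm⟩
  refine ⟨?_, fun ξ h ↦ ⟨ad_inj _ _ fun x ↦ ?_, by rw [h, lie_self]⟩⟩
  · obtain ⟨ξ, h⟩ := exists_ad
    exact ⟨ξ, h, fun η hη ↦ ad_inj _ _ fun x ↦ by rw [← hη, h]⟩
  · calc
      ⁅T.theta ξ, x⁆ = T.theta ⁅ξ, T.theta x⁆ := by rw [T.thetaLie, T.thetaInvol]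
      _ = ⁅-ξ, x⁆ := by rw [← h, T.Dtheta, map_neg, T.thetaInvol, h, neg_lie]
end

section
/- Let (g, Φ = (D, θ), ⟨·,·⟩) be a full extrinsic symmetric triple, i.e., one additionally satisfying g₋⁺ = [g₊⁻, g₋⁻]. Then [g⁻, g⁻] = g⁺, where g⁺ and g⁻ are the (+1)- and (−1)-eigenspaces of τ = id + 2D². -/
theorem bracketSpan_mono {L : Type} [LieRing L] [LieAlgebra ℝ L]
    {U U' V V' : Submodule ℝ L} (hU : U ≤ U') (hV : V ≤ V') :
    bracketSpan U V ≤ bracketSpan U' V' :=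
  Submodule.span_mono fun _ ⟨u, hu, v, hv, h⟩ => ⟨u, hU hu, v, hV hv, h⟩

namespace ExtSymTriple

/-- On `g⁻` one has `D³[u, v] = -4 D[u, v]`, so `D³ = -D` forces `D[u, v] = 0`. -/
theorem D_lie_eq_zero_s14 {L : Type} [LieRing L] [LieAlgebra ℝ L] [Module.Finite ℝ L]
    (T : ExtSymTriple L) {u v : L} (hu : T.D (T.D u) = -u) (hv : T.D (T.D v) = -v) :
    T.D ⁅u, v⁆ = 0 := by
  have h := T.D3 ⁅u, v⁆
  simp only [T.Dder, map_add, hu, hv, neg_lie, lie_neg, map_neg] at h ⊢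
  have h3 : (3 : ℝ) • (⁅T.D u, v⁆ + ⁅u, T.D v⁆) = 0 := by
    linear_combination (norm := module) (-1 : ℝ) • h
  exact (smul_eq_zero.mp h3).resolve_left (by norm_num)

theorem bracketSpan_gDown_le {L : Type} [LieRing L] [LieAlgebra ℝ L] [Module.Finite ℝ L]
    (T : ExtSymTriple L) :
    bracketSpan (LinearMap.ker (T.D ∘ₗ T.D + LinearMap.id))
      (LinearMap.ker (T.D ∘ₗ T.D + LinearMap.id)) ≤ LinearMap.ker T.D := by
  refine Submodule.span_le.mpr ?_
  rintro _ ⟨u, hu, v, hv, rfl⟩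
  exact T.D_lie_eq_zero_s14 (eq_neg_of_add_eq_zero_left hu) (eq_neg_of_add_eq_zero_left hv)

theorem ker_D_le_sup {L : Type} [LieRing L] [LieAlgebra ℝ L] [Module.Finite ℝ L]
    (T : ExtSymTriple L) : LinearMap.ker T.D ≤ T.gPlusUp ⊔ T.gMinusUp := by
  intro x hx
  have hD : T.D x = 0 := hx
  have hθ : T.D (T.theta x) = 0 := by rw [T.Dtheta, hD, map_zero, neg_zero]
  refine Submodule.mem_sup.mpr
    ⟨(2⁻¹ : ℝ) • (x + T.theta x), ⟨?_, ?_⟩, (2⁻¹ : ℝ) • (x - T.theta x), ⟨?_, ?_⟩, ?_⟩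
  · simp [T.thetaInvol, add_comm]
  · simp [hD, hθ]
  · simp [T.thetaInvol]
  · simp [hD, hθ]
  · module

end ExtSymTriple

/-- For a full extrinsic symmetric triple (i.e. one with `g₋⁺ = [g₊⁻, g₋⁻]`), one has
`[g⁻, g⁻] = g⁺`, where `g⁺ = ker D` and `g⁻ = ker (D² + id)` are the eigenspaces of
`τ = id + 2D²`. -/
theorem bracket_gDown_eq_gUp_of_full
    {L : Type} [LieRing L] [LieAlgebra ℝ L] [Module.Finite ℝ L]
    (T : ExtSymTriple L)
    (hfull : T.gMinusUp = bracketSpan T.gPlusDown T.gMinusDown) :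
    bracketSpan (LinearMap.ker (T.D ∘ₗ T.D + LinearMap.id))
        (LinearMap.ker (T.D ∘ₗ T.D + LinearMap.id)) =
      LinearMap.ker T.D := by
  refine le_antisymm T.bracketSpan_gDown_le (T.ker_D_le_sup.trans (sup_le ?_ ?_))
  · exact T.cartan.trans_le (bracketSpan_mono inf_le_right inf_le_right)
  · exact hfull.trans_le (bracketSpan_mono inf_le_right inf_le_right)
end
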